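/- arXiv:math/0404180 — 3 statements merged into one kernel-verified Lean document; each statement's English description precedes it below -/
import Mathlib

section
/- Let M be the L₀-structure described in the context and T = Th(M). Then T is superstable: for every cardinal λ ≥ 2^{ℵ₀}, every model N of T, and every subset A of the universe of N with |A| ≤ λ, there are at most λ complete 1-types over A, i.e., at most λ maximal sets of L₀-formulas in one free variable with parameters from A that are consistent with the elementary diagram of N. In particular T is stable. -/
namespace FirstOrder

open Language Structure

namespace ShelahE34

/-- The function symbols of the language `L₀`: two unary function symbols `F₁` and `F₂`. -/
inductive L0Func : ℕ → Type
  | F₁ : L0Func 1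
  | F₂ : L0Func 1

/-- The relation symbols of the language `L₀`: a unary symbol `Q`, a binary symbol `E` and
binary symbols `Eₙ` for each `n ∈ ℕ`. -/
inductive L0Rel : ℕ → Type
  | Q : L0Rel 1
  | E : L0Rel 2
  | En : ℕ → L0Rel 2

/-- The language `L₀`. -/
def L0 : Language.{0, 0} :=
  ⟨L0Func, L0Rel⟩

/-- The universe of the structure `M`: quadruples `(η, k, n, ℓ)` with `η ∈ 2^ℕ`,
`k, n ∈ ℕ`, `ℓ ∈ {0, 1}` (as a Boolean) and `ℓ = 0` whenever `k = n`. -/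
structure MPoint where
  eta : ℕ → Bool
  k : ℕ
  n : ℕ
  l : Bool
  cond : k = n → l = false

instance : Nonempty MPoint :=
  ⟨⟨fun _ => false, 0, 0, false, fun _ => rfl⟩⟩

/-- The `L₀`-structure `M`. -/
instance L0StructureMPoint : L0.Structure MPoint where
  funMap {m} f x :=
    match f, x with
    | .F₁, x => ⟨(x 0).eta, (x 0).k, (x 0).k, false, fun _ => rfl⟩
    | .F₂, x => ⟨(x 0).eta, (x 0).n, (x 0).n, false, fun _ => rfl⟩
  RelMap {m} r x :=
    match r, x with
    | .Q, x => (x 0).k = (x 0).n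
    | .E, x => (x 0).eta = (x 1).eta
    | .En n, x => ∀ i < n, (x 0).eta i = (x 1).eta i

/-- A formula has the order property with respect to a theory `S` if in some model of `S`
there are tuples `(ā_i)` and `(b̄_j)` such that `φ(ā_i, b̄_j)` holds iff `i < j`. -/
def HasOrderProperty.{u', v', w'} {L' : Language.{u', v'}} (S : L'.Theory) : Prop :=
  ∃ (nx ny : ℕ) (φ : L'.Formula (Fin nx ⊕ Fin ny)) (N : Theory.ModelType.{u', v', w'} S)
    (a : ℕ → Fin nx → N) (b : ℕ → Fin ny → N),
    ∀ i j : ℕ, φ.Realize (Sum.elim (a i) (b j)) ↔ i < j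

/-- A theory is stable if no formula has the order property with respect to it. -/
def IsStableTheory.{u', v', w'} {L' : Language.{u', v'}} (S : L'.Theory) : Prop :=
  ¬ HasOrderProperty.{u', v', w'} S

/-- Finite kinds: `none` is equality, `some none` is `E`, `some (some (f,g))` is `F_f x = F_g y`. -/
abbrev BK := Option (Option (Bool × Bool))

/-- Kinds of atomic binary relations. -/
abbrev Kind := BK ⊕ ℕ

def fsym (f : Bool) : L0.Functions 1 := if f then L0Func.F₁ else L0Func.F₂

def relE : L0.Relations 2 := L0Rel.E
def relEn (n : ℕ) : L0.Relations 2 := L0Rel.En n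

def Kform {β : Type*} (κ : Kind) (i j : β) : L0.Formula β :=
  match κ with
  | .inl none => Term.equal (Term.var i) (Term.var j)
  | .inl (some none) => relE.formula₂ (Term.var i) (Term.var j)
  | .inl (some (some (f, g))) =>
      Term.equal ((fsym f).apply₁ (Term.var i)) ((fsym g).apply₁ (Term.var j))
  | .inr n => (relEn n).formula₂ (Term.var i) (Term.var j)

def Ksem {N : Type*} [L0.Structure N] (κ : Kind) (x y : N) : Prop :=
  match κ with
  | .inl none => x = y
  | .inl (some none) => RelMap relE ![x, y]
  | .inl (some (some (f, g))) => funMap (fsym f) ![x] = funMap (fsym g) ![y]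
  | .inr n => RelMap (relEn n) ![x, y]

theorem realize_Kform {N : Type*} [L0.Structure N] {β : Type*} (κ : Kind) (i j : β) (v : β → N) :
    (Kform κ i j).Realize v ↔ Ksem κ (v i) (v j) := by
  rcases κ with (_ | _ | ⟨f, g⟩) | n <;>
    simp [Kform, Ksem, Formula.realize_equal, Formula.realize_rel₂, Term.realize_functions_apply₁]

namespace MPoint

def c (f : Bool) (x : MPoint) : ℕ := if f then x.k else x.n

def pt (η : ℕ → Bool) (k : ℕ) : MPoint := ⟨η, k, k, false, fun _ => rfl⟩

theorem ext' {x y : MPoint} (h1 : x.eta = y.eta) (h2 : x.k = y.k) (h3 : x.n = y.n)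
    (h4 : x.l = y.l) : x = y := by
  cases x; cases y; simp_all

theorem pt_inj {η η' : ℕ → Bool} {k k' : ℕ} : pt η k = pt η' k' ↔ η = η' ∧ k = k' := by
  simp [pt]

end MPoint

open MPoint

theorem funMap_fsym (f : Bool) (x : MPoint) : funMap (fsym f) ![x] = pt x.eta (c f x) := by
  cases f <;> rfl

theorem Ksem_M_eq (x y : MPoint) : Ksem (.inl none) x y ↔ x = y := Iff.rfl
theorem Ksem_M_E (x y : MPoint) : Ksem (.inl (some none)) x y ↔ x.eta = y.eta := Iff.rfl
theorem Ksem_M_F (f g : Bool) (x y : MPoint) :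
    Ksem (.inl (some (some (f, g)))) x y ↔ x.eta = y.eta ∧ c f x = c g y := by
  simp only [Ksem, funMap_fsym, pt_inj]
theorem Ksem_M_En (n : ℕ) (x y : MPoint) :
    Ksem (.inr n) x y ↔ ∀ i < n, x.eta i = y.eta i := Iff.rfl

theorem Ksem_M_rect (κ : Kind) (x y x' y' : MPoint) (h1 : Ksem κ x y) (h2 : Ksem κ x' y)
    (h3 : Ksem κ x' y') : Ksem κ x y' := by
  rcases κ with (_ | _ | ⟨f, g⟩) | n <;>
    simp only [Ksem_M_eq, Ksem_M_E, Ksem_M_F, Ksem_M_En] at *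
  · grind
  · grind
  · grind
  · grind

/-- reversal of a kind -/
def Krev : Kind → Kind
  | .inl (some (some (f, g))) => .inl (some (some (g, f)))
  | κ => κ

theorem Ksem_M_rev (κ : Kind) (x y : MPoint) : Ksem κ x y → Ksem (Krev κ) y x := by
  rcases κ with (_ | _ | ⟨f, g⟩) | n <;>
    simp only [Ksem_M_eq, Ksem_M_E, Ksem_M_F, Ksem_M_En, Krev] <;> grind

theorem Krev_rev (κ : Kind) : Krev (Krev κ) = κ := by
  rcases κ with (_ | _ | ⟨f, g⟩) | n <;> rfl

/-- the back and forth relation -/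
structure R {β : Type*} (m : ℕ) (v w : β → MPoint) : Prop where
  eta : ∀ i j, (v i).eta = (v j).eta ↔ (w i).eta = (w j).eta
  en : ∀ i j, ∀ k ≤ m, (∀ t < k, (v i).eta t = (v j).eta t) ↔ (∀ t < k, (w i).eta t = (w j).eta t)
  co : ∀ i j, (v i).eta = (v j).eta → ∀ f g, c f (v i) = c g (v j) ↔ c f (w i) = c g (w j)
  eq : ∀ i j, v i = v j ↔ w i = w j

theorem R.comp {β γ : Type*} {m : ℕ} {v w : β → MPoint} (h : R m v w) (s : γ → β) :
    R m (v ∘ s) (w ∘ s) :=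
  ⟨fun _ _ => h.eta _ _, fun _ _ => h.en _ _, fun _ _ => h.co _ _, fun _ _ => h.eq _ _⟩

theorem R.symm {β : Type*} {m : ℕ} {v w : β → MPoint} (h : R m v w) : R m w v :=
  ⟨fun _ _ => (h.eta _ _).symm, fun _ _ _ hk => (h.en _ _ _ hk).symm,
    fun _ _ e _ _ => (h.co _ _ ((h.eta _ _).2 e) _ _).symm, fun _ _ => (h.eq _ _).symm⟩

theorem R.mono {β : Type*} {m m' : ℕ} {v w : β → MPoint} (h : R m v w) (hm : m' ≤ m) : R m' v w :=
  ⟨h.eta, fun _ _ _ hk => h.en _ _ _ (hk.trans hm), h.co, h.eq⟩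

theorem ext_inj {S : Type*} [Finite S] (p q : S → ℕ) (h : ∀ x y, p x = p y ↔ q x = q y) (K : ℕ) :
    ∃ K', ∀ x, K = p x ↔ K' = q x := by
  by_cases hK : ∃ x0, K = p x0
  · obtain ⟨x0, rfl⟩ := hK
    exact ⟨q x0, fun x => h _ _⟩
  · push Not at hK
    obtain ⟨K', hK'⟩ := Infinite.exists_notMem_finset (Set.finite_range q).toFinset
    refine ⟨K', fun x => ⟨fun e => (hK x e).elim, fun e => (hK' ?_).elim⟩⟩
    simp [e]

theorem fresh_eta {β : Type*} [Finite β] (m : ℕ) (s : ℕ → Bool) (w : β → ℕ → Bool) :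
    ∃ η : ℕ → Bool, (∀ t < m, η t = s t) ∧ ∀ j, η ≠ w j := by
  let F : ℕ → ℕ → Bool := fun n t => if t < m then s t else decide (t = m + n)
  have hF : Function.Injective F := by
    intro a b h
    have := congrFun h (m + a)
    simp [F] at this
    exact this
  obtain ⟨x, ⟨n, rfl⟩, hx⟩ := (Set.infinite_range_of_injective hF).exists_notMem_finite
    (Set.finite_range w)
  exact ⟨F n, fun t ht => by simp [F, ht], fun j e => hx ⟨j, e.symm⟩⟩

theorem ext_eta {β : Type*} [Finite β] {m : ℕ} {v w : β → MPoint} (h : R m v w) (a : ℕ → Bool) :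
    ∃ η : ℕ → Bool, (∀ i, a = (v i).eta ↔ η = (w i).eta) ∧
      ∀ i, ∀ k ≤ m, (∀ t < k, a t = (v i).eta t) ↔ (∀ t < k, η t = (w i).eta t) := by
  by_cases h0 : ∃ i, a = (v i).eta
  · obtain ⟨i, rfl⟩ := h0
    exact ⟨(w i).eta, fun j => h.eta i j, fun j => h.en i j⟩
  push Not at h0
  rcases isEmpty_or_nonempty β with hβ | ⟨⟨j0⟩⟩
  · exact ⟨a, fun i => hβ.elim i, fun i => hβ.elim i⟩
  classical
  let P : ℕ → Prop := fun k => ∃ j, ∀ t < k, a t = (v j).eta t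
  have hP0 : P 0 := ⟨j0, by simp⟩
  let k := Nat.findGreatest P m
  have hkm : k ≤ m := Nat.findGreatest_le m
  obtain ⟨j, hj⟩ : P k := Nat.findGreatest_spec (Nat.zero_le m) hP0
  have hmax : ∀ k' ≤ m, P k' → k' ≤ k := fun k' h1 h2 => Nat.le_findGreatest h1 h2
  obtain ⟨η, hη, hne⟩ := fresh_eta m
    (fun t => if t = k then !((w j).eta t) else (w j).eta t) (fun j => (w j).eta)
  have hηj : ∀ t < k, η t = (w j).eta t := fun t ht => by
    rw [hη t (by omega)]; simp [ht.ne]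
  refine ⟨η, fun i => ⟨fun e => (h0 i e).elim, fun e => (hne i e).elim⟩, fun i k' hk' => ?_⟩
  constructor
  · intro e
    have hle := hmax k' hk' ⟨i, e⟩
    have := (h.en j i k' hk').1 (fun t ht => (hj t (by omega)).symm.trans (e t ht))
    intro t ht
    rw [hηj t (by omega), this t ht]
  · intro e
    by_cases hle : k' ≤ k
    · have := (h.en j i k' hk').2 (fun t ht => (hηj t (by omega)).symm.trans (e t ht))
      intro t ht
      rw [hj t (by omega), this t ht]
    · exfalso
      push Not at hle
      have hk1 : k + 1 ≤ m := by omega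
      have e1 : ∀ t < k, (v j).eta t = (v i).eta t :=
        (h.en j i k hkm).2 (fun t ht => (hηj t ht).symm.trans (e t (by omega)))
      have e2 : η k = !((w j).eta k) := by rw [hη k (by omega)]; simp
      have e3 : ¬ ∀ t < k + 1, (v j).eta t = (v i).eta t := by
        rw [h.en j i _ hk1]
        intro e'
        have a1 := e' k (by omega)
        have a2 := e k hle
        rw [e2, a1] at a2
        simp at a2
      have e4 : (v j).eta k ≠ (v i).eta k := by
        intro e'
        exact e3 fun t ht => by
          rcases Nat.lt_succ_iff_lt_or_eq.1 ht with h | rfl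
          · exact e1 t h
          · exact e'
      have e5 : a k ≠ (v j).eta k := by
        intro e'
        have := hmax (k+1) hk1 ⟨j, fun t ht => by
          rcases Nat.lt_succ_iff_lt_or_eq.1 ht with h | rfl
          · exact hj t h
          · exact e'⟩
        omega
      have e6 : a k = (v i).eta k := by
        revert e4 e5
        cases a k <;> cases (v j).eta k <;> cases (v i).eta k <;> simp
      have := hmax (k+1) hk1 ⟨i, fun t ht => by
          rcases Nat.lt_succ_iff_lt_or_eq.1 ht with h | rfl
          · exact (hj t h).trans (e1 t h)
          · exact e6⟩
      omega

theorem R.extend {β : Type*} [Finite β] {m : ℕ} {v w : β → MPoint} (h : R m v w) (a : MPoint) :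
    ∃ b, R m (fun o : Option β => o.elim a v) (fun o : Option β => o.elim b w) := by
  by_cases h0 : ∃ i, a = v i
  · obtain ⟨i, rfl⟩ := h0
    refine ⟨w i, ?_⟩
    have := h.comp (fun o : Option β => o.elim i id)
    convert this using 1 <;> (funext o; cases o <;> rfl)
  push Not at h0
  obtain ⟨η, hη, hη'⟩ := ext_eta h a.eta
  let S := {x : β × Bool // a.eta = (v x.1).eta}
  have hS : ∀ x y : S, c x.1.2 (v x.1.1) = c y.1.2 (v y.1.1) ↔
      c x.1.2 (w x.1.1) = c y.1.2 (w y.1.1) := fun x y => h.co _ _ (x.2.symm.trans y.2) _ _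
  obtain ⟨k', hk'⟩ := ext_inj (fun x : S => c x.1.2 (v x.1.1)) (fun x : S => c x.1.2 (w x.1.1))
    hS a.k
  obtain ⟨n', hn'⟩ := ext_inj (fun x : Option S => x.elim a.k (fun x : S => c x.1.2 (v x.1.1)))
    (fun x : Option S => x.elim k' (fun x : S => c x.1.2 (w x.1.1)))
    (by
      rintro (_ | x) (_ | y)
      · simp
      · exact hk' y
      · simpa [eq_comm] using hk' x
      · exact hS x y) a.n
  have hkn : a.n = a.k ↔ n' = k' := hn' none
  have hn1 : ∀ i, a.eta = (v i).eta → ∀ g, a.n = c g (v i) ↔ n' = c g (w i) :=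
    fun i e g => hn' (some ⟨(i, g), e⟩)
  have hk1 : ∀ i, a.eta = (v i).eta → ∀ g, a.k = c g (v i) ↔ k' = c g (w i) :=
    fun i e g => hk' ⟨(i, g), e⟩
  have key : ∃ b : MPoint, b.eta = η ∧ b.k = k' ∧ b.n = n' ∧ ∀ i, b ≠ w i := by
    by_cases hq : n' = k'
    · refine ⟨⟨η, k', n', false, fun _ => rfl⟩, rfl, rfl, rfl, fun i e => h0 i ?_⟩
      have e0 : a.eta = (v i).eta := (hη i).2 (by rw [← e])
      have ek : a.k = (v i).k := (hk1 i e0 true).2 (by simp [c, ← e])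
      have en : a.n = (v i).n := (hn1 i e0 false).2 (by simp [c, ← e])
      have h3 := hkn.2 hq
      exact ext' e0 ek en (by rw [a.cond h3.symm, (v i).cond (by omega)])
    · have hq' : a.n ≠ a.k := fun e => hq (hkn.1 e)
      have hback : ∀ i, (w i).eta = η → (w i).k = k' → (w i).n = n' →
          a.eta = (v i).eta ∧ a.k = (v i).k ∧ a.n = (v i).n := by
        intro i e1 e2 e3
        have e0 : a.eta = (v i).eta := (hη i).2 e1.symm
        exact ⟨e0, (hk1 i e0 true).2 (by simp [c, e2]), (hn1 i e0 false).2 (by simp [c, e3])⟩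
      have hl : ∀ i, a.eta = (v i).eta ∧ a.k = (v i).k ∧ a.n = (v i).n → (v i).l = !a.l := by
        rintro i ⟨e1, e2, e3⟩
        have : a.l ≠ (v i).l := fun e4 => h0 i (ext' e1 e2 e3 e4)
        revert this
        cases a.l <;> cases (v i).l <;> simp
      by_cases hj : ∃ j, (w j).eta = η ∧ (w j).k = k' ∧ (w j).n = n'
      · obtain ⟨j, j1, j2, j3⟩ := hj
        refine ⟨⟨η, k', n', !(w j).l, fun e => (hq e.symm).elim⟩, rfl, rfl, rfl, fun i e => ?_⟩
        have bi := hback i (by rw [← e]) (by rw [← e]) (by rw [← e])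
        have bj := hback j j1 j2 j3
        have : v i = v j := ext' (by rw [← bi.1, bj.1]) (by rw [← bi.2.1, bj.2.1])
          (by rw [← bi.2.2, bj.2.2]) (by rw [hl i bi, hl j bj])
        have := (h.eq i j).1 this
        have h5 : (w i).l = !(w j).l := by rw [← e]
        rw [this] at h5
        simp at h5
      · exact ⟨⟨η, k', n', false, fun _ => rfl⟩, rfl, rfl, rfl,
          fun i e => hj ⟨i, by rw [← e], by rw [← e], by rw [← e]⟩⟩
  obtain ⟨b, b1, b2, b3, b4⟩ := key
  subst b1 b2 b3
  have hc : ∀ i, a.eta = (v i).eta → ∀ f g, c f a = c g (v i) ↔ c f b = c g (w i) := by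
    intro i e f g
    cases f
    · exact hn1 i e g
    · exact hk1 i e g
  refine ⟨b, ⟨?_, ?_, ?_, ?_⟩⟩
  · rintro (_ | i) (_ | j)
    · simp
    · exact hη j
    · simpa [eq_comm] using hη i
    · exact h.eta i j
  · rintro (_ | i) (_ | j) k hk
    · simp
    · exact hη' j k hk
    · simpa [eq_comm] using hη' i k hk
    · exact h.en i j k hk
  · rintro (_ | i) (_ | j) e f g
    · cases f <;> cases g <;> simp [c, hkn, eq_comm (a := a.k), eq_comm (a := b.k)]
    · exact hc j e f g
    · have := hc i e.symm g f
      simpa [eq_comm] using this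
    · exact h.co i j e f g
  · rintro (_ | i) (_ | j)
    · simp
    · exact iff_of_false (h0 j) (b4 j)
    · exact iff_of_false (Ne.symm (h0 i)) (Ne.symm (b4 i))
    · exact h.eq i j

theorem term_M {β : Type*} (t : L0.Term β) :
    (∃ i, ∀ v : β → MPoint, t.realize v = v i) ∨
      ∃ i f, ∀ v : β → MPoint, t.realize v = pt (v i).eta (c f (v i)) := by
  induction t with
  | var i => exact Or.inl ⟨i, fun v => rfl⟩
  | @func n F ts ih =>
    right
    have key : ∀ g : Bool, ∀ ts : Fin 1 → L0.Term β, ((∃ i, ∀ v : β → MPoint, (ts 0).realize v = v i) ∨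
      ∃ i f, ∀ v : β → MPoint, (ts 0).realize v = pt (v i).eta (c f (v i))) →
      ∃ i f, ∀ v : β → MPoint, (Term.func (fsym g) ts).realize v = pt (v i).eta (c f (v i)) := by
      intro g ts ih
      have e : ∀ v : β → MPoint, (Term.func (fsym g) ts).realize v =
          pt ((ts 0).realize v).eta (c g ((ts 0).realize v)) := by
        intro v
        rw [← funMap_fsym, Term.realize]
        congr 1
        funext i
        fin_cases i; rfl
      rcases ih with ⟨i, hi⟩ | ⟨i, f, hi⟩
      · exact ⟨i, g, fun v => by rw [e, hi]⟩
      · refine ⟨i, f, fun v => ?_⟩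
        rw [e, hi]
        cases g <;> rfl
    cases F
    · exact key true ts (ih 0)
    · exact key false ts (ih 0)

theorem R.term_eta {β : Type*} {m : ℕ} {v w : β → MPoint} (h : R m v w) (s t : L0.Term β) :
    (s.realize v).eta = (t.realize v).eta ↔ (s.realize w).eta = (t.realize w).eta := by
  rcases term_M s with ⟨i, hi⟩ | ⟨i, f, hi⟩ <;> rcases term_M t with ⟨j, hj⟩ | ⟨j, g, hj⟩ <;>
    simp only [hi, hj] <;> exact h.eta i j

theorem R.term_en {β : Type*} {m : ℕ} {v w : β → MPoint} (h : R m v w) (s t : L0.Term β)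
    (k : ℕ) (hk : k ≤ m) :
    (∀ r < k, (s.realize v).eta r = (t.realize v).eta r) ↔
      (∀ r < k, (s.realize w).eta r = (t.realize w).eta r) := by
  rcases term_M s with ⟨i, hi⟩ | ⟨i, f, hi⟩ <;> rcases term_M t with ⟨j, hj⟩ | ⟨j, g, hj⟩ <;>
    simp only [hi, hj] <;> exact h.en i j k hk

theorem eq_pt_iff (x : MPoint) (η : ℕ → Bool) (k : ℕ) :
    x = pt η k ↔ x.eta = η ∧ c true x = c false x ∧ c true x = k := by
  constructor
  · rintro rfl; simp [pt, c]
  · rintro ⟨h1, h2, h3⟩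
    simp only [c, if_true, Bool.false_eq_true, if_false] at h2 h3
    exact ext' h1 h3 (by simp [pt]; omega) (x.cond h2)

theorem R.term_eq {β : Type*} {m : ℕ} {v w : β → MPoint} (h : R m v w) (s t : L0.Term β) :
    s.realize v = t.realize v ↔ s.realize w = t.realize w := by
  have h1 : ∀ i j g, v i = pt (v j).eta (c g (v j)) ↔ w i = pt (w j).eta (c g (w j)) := by
    intro i j g
    rw [eq_pt_iff, eq_pt_iff, ← h.eta i j]
    refine and_congr_right fun e => ?_
    rw [h.co i i rfl, h.co i j e]
  rcases term_M s with ⟨i, hi⟩ | ⟨i, f, hi⟩ <;> rcases term_M t with ⟨j, hj⟩ | ⟨j, g, hj⟩ <;>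
    simp only [hi, hj]
  · exact h.eq i j
  · exact h1 i j g
  · rw [eq_comm, h1 j i f, eq_comm]
  · rw [pt_inj, pt_inj, ← h.eta i j]
    exact and_congr_right fun e => h.co i j e f g

theorem R.term_Q {β : Type*} {m : ℕ} {v w : β → MPoint} (h : R m v w) (s : L0.Term β) :
    (s.realize v).k = (s.realize v).n ↔ (s.realize w).k = (s.realize w).n := by
  rcases term_M s with ⟨i, hi⟩ | ⟨i, f, hi⟩ <;> simp only [hi]
  · exact h.co i i rfl true false
  · simp [pt]

theorem qe_M {α : Type*} [Finite α] {n : ℕ} (φ : L0.BoundedFormula α n) :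
    ∃ m, ∀ (v w : α → MPoint) (xs ys : Fin n → MPoint), R m (Sum.elim v xs) (Sum.elim w ys) →
      (φ.Realize v xs ↔ φ.Realize w ys) := by
  induction φ with
  | falsum => exact ⟨0, fun _ _ _ _ _ => Iff.rfl⟩
  | equal s t => exact ⟨0, fun _ _ _ _ h => h.term_eq s t⟩
  | rel r ts =>
    cases r with
    | Q => exact ⟨0, fun _ _ _ _ h => h.term_Q (ts 0)⟩
    | E => exact ⟨0, fun _ _ _ _ h => h.term_eta (ts 0) (ts 1)⟩
    | En k => exact ⟨k, fun _ _ _ _ h => h.term_en (ts 0) (ts 1) k le_rfl⟩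
  | imp φ ψ ih1 ih2 =>
    obtain ⟨m1, h1⟩ := ih1
    obtain ⟨m2, h2⟩ := ih2
    refine ⟨max m1 m2, fun v w xs ys h => ?_⟩
    simp only [BoundedFormula.realize_imp]
    rw [h1 v w xs ys (h.mono (le_max_left _ _)), h2 v w xs ys (h.mono (le_max_right _ _))]
  | @all n φ ih =>
    obtain ⟨m, hm⟩ := ih
    have key : ∀ (v w : α → MPoint) (xs ys : Fin n → MPoint),
        R m (Sum.elim v xs) (Sum.elim w ys) →
        (φ.all.Realize w ys → φ.all.Realize v xs) := by
      intro v w xs ys h hr a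
      obtain ⟨b, hb⟩ := h.extend a
      refine (hm _ _ _ _ ?_).2 (hr b)
      have := hb.comp (Sum.elim (fun x => some (Sum.inl x))
        (Fin.snoc (fun i => some (Sum.inr i)) none) : α ⊕ Fin (n+1) → Option (α ⊕ Fin n))
      convert this using 1
      · funext x
        rcases x with x | x
        · rfl
        · refine Fin.lastCases ?_ (fun i => ?_) x <;> simp
      · funext x
        rcases x with x | x
        · rfl
        · refine Fin.lastCases ?_ (fun i => ?_) x <;> simp
    exact ⟨m, fun v w xs ys h => ⟨key w v ys xs h.symm, key v w xs ys h⟩⟩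

theorem transfer {L : Language} {M N : Type*} [L.Structure M] [L.Structure N]
    (hN : N ⊨ L.completeTheory M) {α : Type*} [Finite α] (φ : L.Formula α)
    (h : ∀ v : α → M, φ.Realize v) (v : α → N) : φ.Realize v := by
  let σ : L.Sentence := Formula.iAlls α (φ.relabel (Sum.inr : α → Empty ⊕ α))
  have h1 : M ⊨ σ := by
    simp only [σ, Sentence.Realize, Formula.realize_iAlls, Formula.realize_relabel]
    intro i
    exact h _
  have h2 : N ⊨ σ := hN.realize_of_mem σ h1
  simp only [σ, Sentence.Realize, Formula.realize_iAlls, Formula.realize_relabel] at h2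
  exact h2 v

def Kfin (m : ℕ) : Set Kind := Set.range Sum.inl ∪ Sum.inr '' Set.Iic m

theorem Kfin_finite (m : ℕ) : (Kfin m).Finite :=
  (Set.finite_range _).union ((Set.finite_Iic m).image _)

theorem R_of_Ksem {β : Type*} {m : ℕ} {v w : β → MPoint}
    (h : ∀ κ ∈ Kfin m, ∀ i j, Ksem κ (v i) (v j) ↔ Ksem κ (w i) (w j)) : R m v w := by
  have hl : ∀ b : BK, (Sum.inl b : Kind) ∈ Kfin m := fun b => Or.inl ⟨b, rfl⟩
  have he := h _ (hl (some none))
  refine ⟨he, fun i j k hk => h (.inr k) (Or.inr ⟨k, hk, rfl⟩) i j, fun i j e f g => ?_,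
    h _ (hl none)⟩
  have := h _ (hl (some (some (f, g)))) i j
  rw [Ksem_M_F, Ksem_M_F] at this
  have e' := (he i j).1 e
  rw [Ksem_M_E] at e'
  simpa [e, e'] using this

section model

variable {N : Type*} [L0.Structure N] (hN : N ⊨ L0.completeTheory MPoint)

include hN

theorem qe_fin {β : Type*} [Finite β] (φ : L0.Formula β) :
    ∃ m, ∀ v w : β → N, (∀ κ ∈ Kfin m, ∀ i j, Ksem κ (v i) (v j) ↔ Ksem κ (w i) (w j)) →
      (φ.Realize v ↔ φ.Realize w) := by
  obtain ⟨m, hm⟩ := qe_M φ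
  refine ⟨m, fun v w h => ?_⟩
  have := (Kfin_finite m).to_subtype
  let χ : L0.Formula (β ⊕ β) :=
    (Formula.iInf (fun x : Kfin m × β × β =>
      (Kform x.1.1 (Sum.inl x.2.1) (Sum.inl x.2.2)).iff
        (Kform x.1.1 (Sum.inr x.2.1) (Sum.inr x.2.2)))).imp
      ((φ.relabel Sum.inl).iff (φ.relabel Sum.inr))
  have h1 := transfer hN χ (by
    intro u
    simp only [χ, Formula.realize_imp, Formula.realize_iInf, Formula.realize_iff,
      Formula.realize_relabel, realize_Kform]
    intro hu
    refine hm _ _ _ _ ?_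
    have h2 : R m (u ∘ Sum.inl) (u ∘ Sum.inr) :=
      R_of_Ksem (fun κ hκ i j => hu (⟨κ, hκ⟩, i, j))
    have h3 := h2.comp (Sum.elim id (fun i => i.elim0) : β ⊕ Fin 0 → β)
    convert h3 using 1 <;>
    · funext x
      rcases x with x | x
      · rfl
      · exact x.elim0) (Sum.elim v w)
  simp only [χ, Formula.realize_imp, Formula.realize_iInf, Formula.realize_iff,
      Formula.realize_relabel, realize_Kform] at h1
  exact h1 (fun x => h x.1.1 x.1.2 x.2.1 x.2.2)

theorem qe_N {β : Type*} (φ : L0.Formula β) :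
    ∃ Δ : Set (Kind × β × β), Δ.Finite ∧ ∀ v w : β → N,
      (∀ δ ∈ Δ, Ksem δ.1 (v δ.2.1) (v δ.2.2) ↔ Ksem δ.1 (w δ.2.1) (w δ.2.2)) →
      (φ.Realize v ↔ φ.Realize w) := by
  classical
  let s : Finset β := BoundedFormula.freeVarFinset φ
  let φ' : L0.Formula s := BoundedFormula.restrictFreeVar φ id
  have hφ' : ∀ v : β → N, φ'.Realize (fun x : s => v x) ↔ φ.Realize v := fun v =>
    BoundedFormula.realize_restrictFreeVar (φ := φ) (f := id) v (fun a => rfl)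
  obtain ⟨m, hm⟩ := qe_fin hN φ'
  refine ⟨Kfin m ×ˢ (s : Set β) ×ˢ (s : Set β),
    (Kfin_finite m).prod (s.finite_toSet.prod s.finite_toSet), fun v w h => ?_⟩
  rw [← hφ' v, ← hφ' w]
  exact hm _ _ fun κ hκ i j => h (κ, i.1, j.1) ⟨hκ, i.2, j.2⟩

theorem Ksem_rect (κ : Kind) {x y x' y' : N} (h1 : Ksem κ x y) (h2 : Ksem κ x' y)
    (h3 : Ksem κ x' y') : Ksem κ x y' := by
  let χ : L0.Formula (Fin 4) :=
    (Kform κ 0 1).imp ((Kform κ 2 1).imp ((Kform κ 2 3).imp (Kform κ 0 3)))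
  have := transfer hN χ (by
    intro v
    simp only [χ, Formula.realize_imp, realize_Kform]
    exact Ksem_M_rect κ _ _ _ _) ![x, y, x', y']
  simp only [χ, Formula.realize_imp, realize_Kform] at this
  exact this h1 h2 h3

theorem Ksem_rev (κ : Kind) (x y : N) : Ksem κ x y ↔ Ksem (Krev κ) y x := by
  have key : ∀ κ, ∀ x y : N, Ksem κ x y → Ksem (Krev κ) y x := by
    intro κ x y
    let χ : L0.Formula (Fin 2) := (Kform κ 0 1).imp (Kform (Krev κ) 1 0)
    have := transfer hN χ (by
      intro v
      simp only [χ, Formula.realize_imp, realize_Kform]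
      exact Ksem_M_rev κ _ _) ![x, y]
    simp only [χ, Formula.realize_imp, realize_Kform] at this
    exact this
  refine ⟨key κ x y, fun h => ?_⟩
  have := key _ _ _ h
  rwa [Krev_rev] at this

theorem Ksem_En_refl (n : ℕ) (x : N) : Ksem (.inr n) x x := by
  have := transfer hN (Kform (.inr n) 0 0 : L0.Formula (Fin 1)) (by
      intro v
      simp [realize_Kform, Ksem_M_En]) ![x]
  simpa [realize_Kform] using this

theorem Ksem_En_fin (n : ℕ) (x : Option (Fin n → Bool) → N) :
    ∃ i j, i ≠ j ∧ Ksem (.inr n) (x i) (x j) := by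
  let χ : L0.Formula (Option (Fin n → Bool)) :=
    Formula.iSup (fun p : {p : Option (Fin n → Bool) × Option (Fin n → Bool) // p.1 ≠ p.2} =>
      Kform (.inr n) p.1.1 p.1.2)
  have := transfer hN χ (by
    intro v
    simp only [χ, Formula.realize_iSup, realize_Kform]
    obtain ⟨i, j, hij, e⟩ := Fintype.exists_ne_map_eq_of_card_lt
      (fun i => (fun t : Fin n => (v i).eta t)) (by simp)
    refine ⟨⟨(i, j), hij⟩, ?_⟩
    rw [Ksem_M_En]
    exact fun t ht => congrFun e ⟨t, ht⟩) x
  simp only [χ, Formula.realize_iSup, realize_Kform] at this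
  obtain ⟨p, hp⟩ := this
  exact ⟨_, _, p.2, hp⟩

theorem exists_reps (A : Set N) (n : ℕ) :
    ∃ B : Set A, B.Finite ∧ ∀ a : A, ∃ b ∈ B, Ksem (.inr n) (b : N) (a : N) := by
  have hsymm : ∀ x y : N, Ksem (.inr n) x y → Ksem (.inr n) y x := fun x y h =>
    (Ksem_rev hN (.inr n) x y).1 h
  let s : Setoid A := ⟨fun a b => Ksem (.inr n) (a : N) (b : N),
    ⟨fun a => Ksem_En_refl hN n _, fun h => hsymm _ _ h,
      fun {a b c} h1 h2 => Ksem_rect hN _ h1 (Ksem_En_refl hN n _) h2⟩⟩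
  have hfin : Finite (Quotient s) := by
    by_contra hinf
    rw [not_finite_iff_infinite] at hinf
    obtain ⟨e⟩ : Nonempty (Option (Fin n → Bool) ↪ Quotient s) :=
      ⟨(Finite.equivFin (Option (Fin n → Bool))).toEmbedding.trans
        (Fin.valEmbedding.trans (Infinite.natEmbedding _))⟩
    obtain ⟨i, j, hij, h⟩ := Ksem_En_fin hN n (fun i => ((e i).out : N))
    apply hij
    apply e.injective
    rw [← Quotient.out_eq (e i), ← Quotient.out_eq (e j)]
    exact Quotient.sound h
  refine ⟨Set.range (Quotient.out : Quotient s → A), Set.finite_range _, fun a => ?_⟩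
  exact ⟨_, ⟨⟦a⟧, rfl⟩, Quotient.mk_out (s := s) a⟩

omit hN in
theorem ultra_comm {U : Ultrafilter ℕ} {r : ℕ → ℕ → Prop}
    (hr : ∀ i j i' j', r i j → r i' j → r i' j' → r i j')
    (h : ∀ᶠ i in U, ∀ᶠ j in U, r i j) : ∀ᶠ j in U, ∀ᶠ i in U, r i j := by
  obtain ⟨i0, hi0⟩ := h.exists
  filter_upwards [hi0] with j hj
  filter_upwards [h] with i hi
  obtain ⟨j', h1, h2⟩ := (hi.and hi0).exists
  exact hr i j' i0 j h1 h2 hj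

omit hN in
theorem ultra_comm_iff {U : Ultrafilter ℕ} {r : ℕ → ℕ → Prop}
    (hr : ∀ i j i' j', r i j → r i' j → r i' j' → r i j') :
    (∀ᶠ i in U, ∀ᶠ j in U, r i j) ↔ ∀ᶠ j in U, ∀ᶠ i in U, r i j :=
  ⟨ultra_comm hr, ultra_comm (r := fun j i => r i j)
    (fun i j i' j' h1 h2 h3 => hr j' i' j i h3 h2 h1)⟩

theorem no_order {nx ny : ℕ} (φ : L0.Formula (Fin nx ⊕ Fin ny))
    (a : ℕ → Fin nx → N) (b : ℕ → Fin ny → N)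
    (h : ∀ i j : ℕ, φ.Realize (Sum.elim (a i) (b j)) ↔ i < j) : False := by
  obtain ⟨Δ, hΔ, hφ⟩ := qe_N hN φ
  let U : Ultrafilter ℕ := Filter.hyperfilter ℕ
  have hgt : ∀ i : ℕ, ∀ᶠ j in U, i < j := fun i =>
    Nat.hyperfilter_le_atTop (Filter.eventually_gt_atTop i)
  let r : Kind × (Fin nx ⊕ Fin ny) × (Fin nx ⊕ Fin ny) → ℕ → ℕ → Prop := fun δ i j =>
    Ksem δ.1 (Sum.elim (a i) (b j) δ.2.1) (Sum.elim (a i) (b j) δ.2.2)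
  have hcomm : ∀ δ, (∀ᶠ i in U, ∀ᶠ j in U, r δ i j) ↔ ∀ᶠ j in U, ∀ᶠ i in U, r δ i j := by
    rintro ⟨κ, (s | s), (t | t)⟩
    · simp [r]
    · exact ultra_comm_iff fun i j i' j' h1 h2 h3 => Ksem_rect hN κ h1 h2 h3
    · exact ultra_comm_iff fun i j i' j' h1 h2 h3 => Ksem_rect hN κ h3 h2 h1
    · simp [r]
  let T : Kind × (Fin nx ⊕ Fin ny) × (Fin nx ⊕ Fin ny) → Prop := fun δ =>
    ∀ᶠ i in U, ∀ᶠ j in U, r δ i j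
  have h1 : ∀ᶠ i in U, ∀ᶠ j in U, ∀ δ ∈ Δ, (r δ i j ↔ T δ) := by
    have : ∀ᶠ i in (U : Filter ℕ), ∀ δ ∈ Δ, ∀ᶠ j in (U : Filter ℕ), (r δ i j ↔ T δ) := by
      rw [Filter.eventually_all_finite hΔ]
      intro δ _
      by_cases hT : T δ
      · simp only [hT, iff_true]
        exact hT
      · simp only [hT, iff_false, Ultrafilter.eventually_not]
        exact hT
    filter_upwards [this] with i hi
    rwa [Filter.eventually_all_finite hΔ]
  have h2 : ∀ᶠ j in U, ∀ᶠ i in U, ∀ δ ∈ Δ, (r δ i j ↔ T δ) := by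
    have : ∀ᶠ j in (U : Filter ℕ), ∀ δ ∈ Δ, ∀ᶠ i in (U : Filter ℕ), (r δ i j ↔ T δ) := by
      rw [Filter.eventually_all_finite hΔ]
      intro δ _
      by_cases hT : T δ
      · simpa only [hT, iff_true] using (hcomm δ).1 hT
      · simp only [hT, iff_false, Ultrafilter.eventually_not]
        exact fun h => hT ((hcomm δ).2 h)
    filter_upwards [this] with i hi
    rwa [Filter.eventually_all_finite hΔ]
  obtain ⟨i, hi⟩ := h1.exists
  obtain ⟨j, hj, hij⟩ := (hi.and (hgt i)).exists
  obtain ⟨j', hj'⟩ := h2.exists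
  obtain ⟨i', hi', hij'⟩ := (hj'.and (hgt j')).exists
  have := hφ (Sum.elim (a i) (b j)) (Sum.elim (a i') (b j'))
    (fun δ hδ => (hj δ hδ).trans (hi' δ hδ).symm)
  rw [h, h] at this
  omega

end model

section types

variable {N : Type u} [L0.Structure N] (A : Set N)

/-- the type contains the formula with parameters -/
def holds (p : Theory.CompleteType ((L0[[↥A]]).completeTheory N) (Fin 1))
    (ψ : L0.Formula (A ⊕ Fin 1)) : Prop :=
  Formula.equivSentence (BoundedFormula.constantsVarsEquiv.symm ψ : (L0[[↥A]]).Formula (Fin 1)) ∈ p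

theorem holds_ext (p q : Theory.CompleteType ((L0[[↥A]]).completeTheory N) (Fin 1))
    (h : ∀ ψ, holds A p ψ ↔ holds A q ψ) : p = q := by
  refine SetLike.ext fun σ => ?_
  have := h (BoundedFormula.constantsVarsEquiv (Formula.equivSentence.symm σ))
  simpa [holds] using this

/-- valuation -/
def val (x : N) : A ⊕ Fin 1 → N := Sum.elim (fun a => (a : N)) (fun _ => x)

theorem fin_approx (p : Theory.CompleteType ((L0[[↥A]]).completeTheory N) (Fin 1))
    (Γ : Set (L0.Formula (A ⊕ Fin 1))) (hΓ : Γ.Finite) :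
    ∃ x : N, ∀ ψ ∈ Γ, (holds A p ψ ↔ ψ.Realize (val A x)) := by
  classical
  obtain ⟨M', v, hv⟩ := Theory.exists_modelType_is_realized_in _ p
  by_contra hcon
  push Not at hcon
  have := hΓ.to_subtype
  let conv : L0.Formula (A ⊕ Fin 1) → (L0[[↥A]]).Formula (Fin 1) := fun ψ =>
    BoundedFormula.constantsVarsEquiv.symm ψ
  have hconv : ∀ ψ (y : Fin 1 → N), (conv ψ).Realize y ↔ ψ.Realize (val A (y 0)) := by
    intro ψ y
    have := BoundedFormula.realize_constantsVarsEquiv (L := L0) (M := N)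
      (φ := conv ψ) (v := y) (xs := default)
    simp only [conv, Equiv.apply_symm_apply] at this
    refine this.symm.trans ?_
    have e : (Sum.elim (fun a : A => ((L0.con a : (L0[[↥A]]).Constants) : N)) y) = val A (y 0) := by
      funext z
      rcases z with z | z
      · simp [val]
      · fin_cases z; rfl
    rw [e]
    rfl
  let χ : (L0[[↥A]]).Formula (Fin 1) :=
    (Formula.iInf (fun ψ : Γ => if holds A p ψ.1 then conv ψ.1 else (conv ψ.1).not)).not
  have h1 := transfer (L := L0[[↥A]]) (M := N) (N := M') M'.is_model χ (by
    intro y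
    simp only [χ, Formula.realize_not, Formula.realize_iInf]
    intro hall
    obtain ⟨ψ, hψ, hne⟩ := hcon (y 0)
    have := hall ⟨ψ, hψ⟩
    by_cases hp : holds A p ψ
    · simp only [hp, if_true, hconv] at this
      tauto
    · simp only [hp, if_false, Formula.realize_not, hconv] at this
      tauto) v
  simp only [χ, Formula.realize_not, Formula.realize_iInf] at h1
  apply h1
  intro ψ
  have hm : holds A p ψ.1 ↔ (conv ψ.1).Realize v := by
    rw [← hv]
    exact Theory.CompleteType.formula_mem_typeOf
  by_cases hp : holds A p ψ.1
  · simp only [hp, if_true]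
    exact hm.1 hp
  · simp only [hp, if_false, Formula.realize_not]
    exact fun h => hp (hm.2 h)

/-- atomic relation between the variable and a parameter -/
def xa (κ : Kind) (a : A) : L0.Formula (A ⊕ Fin 1) := Kform κ (Sum.inr 0) (Sum.inl a)

variable (hN : N ⊨ L0.completeTheory MPoint)

include hN

theorem types_eq_of_atoms (p q : Theory.CompleteType ((L0[[↥A]]).completeTheory N) (Fin 1))
    (h1 : ∀ κ a, holds A p (xa A κ a) ↔ holds A q (xa A κ a))
    (h2 : ∀ κ, holds A p (Kform κ (Sum.inr 0) (Sum.inr 0)) ↔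
      holds A q (Kform κ (Sum.inr 0) (Sum.inr 0))) : p = q := by
  refine holds_ext A p q fun φ => ?_
  obtain ⟨Δ, hΔ, hφ⟩ := qe_N hN φ
  let Γ : Set (L0.Formula (A ⊕ Fin 1)) := {φ} ∪ (fun δ => Kform δ.1 δ.2.1 δ.2.2) '' Δ ∪
    (fun δ => Kform (Krev δ.1) δ.2.2 δ.2.1) '' Δ
  have hΓ : Γ.Finite := ((Set.finite_singleton _).union (hΔ.image _)).union (hΔ.image _)
  obtain ⟨x, hx⟩ := fin_approx A p Γ hΓ
  obtain ⟨y, hy⟩ := fin_approx A q Γ hΓ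
  have hφΓ : φ ∈ Γ := Or.inl (Or.inl rfl)
  rw [hx φ hφΓ, hy φ hφΓ]
  refine hφ _ _ fun δ hδ => ?_
  have m1 : Kform δ.1 δ.2.1 δ.2.2 ∈ Γ := Or.inl (Or.inr ⟨δ, hδ, rfl⟩)
  have m2 : Kform (Krev δ.1) δ.2.2 δ.2.1 ∈ Γ := Or.inr ⟨δ, hδ, rfl⟩
  have x1 := hx _ m1
  have x2 := hx _ m2
  have y1 := hy _ m1
  have y2 := hy _ m2
  rw [realize_Kform] at x1 x2 y1 y2
  obtain ⟨κ, i, j⟩ := δ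
  rcases i with a | z
  · rcases j with b | z
    · exact Iff.rfl
    · obtain rfl := Subsingleton.elim z 0
      rw [Ksem_rev hN, Ksem_rev hN κ, ← x2, ← y2]
      exact h1 (Krev κ) a
  · obtain rfl := Subsingleton.elim z 0
    rcases j with b | z
    · rw [← x1, ← y1]
      exact h1 κ b
    · obtain rfl := Subsingleton.elim z 0
      rw [← x1, ← y1]
      exact h2 κ

theorem xa_step (p q : Theory.CompleteType ((L0[[↥A]]).completeTheory N) (Fin 1)) (κ : Kind)
    (a a' : A) (hp : holds A p (xa A κ a)) (hq : holds A q (xa A κ a))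
    (hp' : holds A p (xa A κ a')) : holds A q (xa A κ a') := by
  obtain ⟨x, hx⟩ := fin_approx A p {xa A κ a, xa A κ a'} (Set.toFinite _)
  obtain ⟨y, hy⟩ := fin_approx A q {xa A κ a, xa A κ a'} (Set.toFinite _)
  have x1 := (hx (xa A κ a) (by simp)).1 hp
  have x2 := (hx (xa A κ a') (by simp)).1 hp'
  have y1 := (hy (xa A κ a) (by simp)).1 hq
  refine (hy (xa A κ a') (by simp)).2 ?_
  simp only [xa, realize_Kform] at *
  exact Ksem_rect hN κ y1 x1 x2

theorem xa_move (p : Theory.CompleteType ((L0[[↥A]]).completeTheory N) (Fin 1)) (n : ℕ)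
    (a b : A) (hp : holds A p (xa A (.inr n) a)) (hab : Ksem (.inr n) (b : N) (a : N)) :
    holds A p (xa A (.inr n) b) := by
  obtain ⟨x, hx⟩ := fin_approx A p {xa A (.inr n) a, xa A (.inr n) b} (Set.toFinite _)
  have x1 := (hx (xa A (.inr n) a) (by simp)).1 hp
  refine (hx (xa A (.inr n) b) (by simp)).2 ?_
  simp only [xa, realize_Kform] at *
  exact Ksem_rect hN _ x1 hab (Ksem_En_refl hN n _)

open Cardinal in
theorem card_types (lam : Cardinal.{u}) (hlam : (2 : Cardinal.{u}) ^ (ℵ₀ : Cardinal.{u}) ≤ lam)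
    (hA : #A ≤ lam) :
    #(Theory.CompleteType ((L0[[↥A]]).completeTheory N) (Fin 1)) ≤ lam := by
  classical
  choose B hBf hB using exists_reps hN A
  let B0 : Set A := ⋃ n, B n
  have hB0 : B0.Countable := Set.countable_iUnion fun n => (hBf n).countable
  have hl0 : ℵ₀ ≤ lam := (Cardinal.cantor ℵ₀).le.trans hlam
  -- choice of witnesses
  let P := Theory.CompleteType ((L0[[↥A]]).completeTheory N) (Fin 1)
  let d1 : P → ULift.{u} BK → Option A := fun p b =>
    if h : ∃ a, holds A p (xa A (.inl b.down) a) then some h.choose else none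
  let d2 : P → ULift.{u} ℕ → Option B0 := fun p n =>
    if h : ∃ b : B0, holds A p (xa A (.inr n.down) b.1) then some h.choose else none
  let d3 : P → Set (ULift.{u} Kind) := fun p =>
    {κ | holds A p (Kform κ.down (Sum.inr 0) (Sum.inr 0))}
  let D : P → (ULift.{u} BK → Option A) × (ULift.{u} ℕ → Option B0) × Set (ULift.{u} Kind) :=
    fun p => (d1 p, d2 p, d3 p)
  have key1 : ∀ p q : P, d1 p = d1 q → ∀ b a, holds A p (xa A (.inl b) a) →
      holds A q (xa A (.inl b) a) := by
    intro p q e b a hp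
    have hpe : ∃ a, holds A p (xa A (.inl b) a) := ⟨a, hp⟩
    have e1 := congrFun e ⟨b⟩
    simp only [d1, dif_pos hpe] at e1
    split_ifs at e1 with hqe
    have e2 := Option.some.inj e1
    have hc := hqe.choose_spec
    rw [← e2] at hc
    exact xa_step A hN p q _ _ _ hpe.choose_spec hc hp
  have key2 : ∀ p q : P, d2 p = d2 q → ∀ n a, holds A p (xa A (.inr n) a) →
      holds A q (xa A (.inr n) a) := by
    intro p q e n a hp
    obtain ⟨b, hb, hab⟩ := hB n a
    have hpe : ∃ b : B0, holds A p (xa A (.inr n) b.1) :=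
      ⟨⟨b, Set.mem_iUnion.2 ⟨n, hb⟩⟩, xa_move A hN p n a b hp hab⟩
    have e1 := congrFun e ⟨n⟩
    simp only [d2, dif_pos hpe] at e1
    split_ifs at e1 with hqe
    have e2 := Option.some.inj e1
    have hc := hqe.choose_spec
    rw [← e2] at hc
    exact xa_step A hN p q _ _ _ hpe.choose_spec hc hp
  have hD : Function.Injective D := by
    intro p q e
    simp only [D, Prod.mk.injEq] at e
    obtain ⟨e1, e2, e3⟩ := e
    refine types_eq_of_atoms A hN p q ?_ fun κ => ?_
    · rintro (b | n) a
      · exact ⟨key1 p q e1 b a, key1 q p e1.symm b a⟩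
      · exact ⟨key2 p q e2 n a, key2 q p e2.symm n a⟩
    · exact Set.ext_iff.1 e3 ⟨κ⟩
  have hopt : #(Option A) ≤ lam := by
    rw [mk_option]
    exact add_le_of_le hl0 hA (one_le_aleph0.trans hl0)
  have c1 : #(ULift.{u} BK → Option A) ≤ lam := by
    obtain ⟨n, hn⟩ := Cardinal.lt_aleph0.1 (Cardinal.lt_aleph0_of_finite (ULift.{u} BK))
    rw [← Cardinal.power_def, hn]
    exact (Cardinal.power_le_power_right hopt).trans (Cardinal.power_nat_le hl0)
  have c2 : #(ULift.{u} ℕ → Option B0) ≤ lam := by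
    have : Countable B0 := hB0
    rw [← Cardinal.power_def]
    refine le_trans ?_ hlam
    rw [← Cardinal.power_self_eq le_rfl]
    have h1 : #(ULift.{u} ℕ) = ℵ₀ := by simp
    rw [h1]
    exact Cardinal.power_le_power_right (Cardinal.mk_le_aleph0)
  have c3 : #(Set (ULift.{u} Kind)) ≤ lam := by
    rw [Cardinal.mk_set]
    refine le_trans ?_ hlam
    exact Cardinal.power_le_power_left two_ne_zero Cardinal.mk_le_aleph0
  refine (Cardinal.mk_le_of_injective hD).trans ?_
  simp only [Cardinal.mk_prod, Cardinal.lift_id]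
  exact mul_le_of_le hl0 c1 (mul_le_of_le hl0 c2 c3)

end types

theorem ThM_superstable :
    (∀ lam : Cardinal.{u}, (2 : Cardinal.{u}) ^ (Cardinal.aleph0 : Cardinal.{u}) ≤ lam →
      ∀ (N : Type u) (_ : L0.Structure N) (_ : Nonempty N),
        N ⊨ L0.completeTheory MPoint →
          ∀ A : Set N, Cardinal.mk A ≤ lam →
            Cardinal.mk
              (Theory.CompleteType ((L0[[↥A]]).completeTheory N) (Fin 1)) ≤ lam) ∧
    IsStableTheory.{0, 0, u} (L0.completeTheory MPoint) := by
  refine ⟨fun lam hlam N _ _ hN A hA => card_types A hN lam hlam hA, ?_⟩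
  rintro ⟨nx, ny, φ, N, a, b, h⟩
  exact no_order N.is_model φ a b h

end ShelahE34

end FirstOrder
end

section
/- There exists a bijection f of the Cantor space 2^ℕ (the set of functions from ℕ to {0,1}) onto itself such that: (α) for all η, ν ∈ 2^ℕ and all n ∈ ℕ, if η↾n = ν↾n then f(η)↾n = f(ν)↾n; and (β) for every integer m ≥ 1 there exists n ∈ ℕ such that for every η ∈ 2^ℕ, f^m(η)↾n ≠ η↾n, where f^m denotes the m-fold iterate of f. -/
def odoStep (b : Bool) (η : ℕ → Bool) : ℕ → Bool :=
  fun i => xor (η i) (decide (∀ j < i, η j = b))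

theorem odoStep_all (b : Bool) (η : ℕ → Bool) (i : ℕ) :
    (∀ j < i, odoStep b η j = !b) ↔ (∀ j < i, η j = b) := by
  induction i with
  | zero => simp
  | succ i ih =>
    rw [Nat.forall_lt_succ_right, Nat.forall_lt_succ_right, ih]
    refine and_congr_right fun h => ?_
    have : odoStep b η i = xor (η i) true := by
      unfold odoStep
      rw [decide_eq_true h]
    rw [this]
    cases η i <;> cases b <;> simp

theorem odoStep_inv (b : Bool) (η : ℕ → Bool) : odoStep (!b) (odoStep b η) = η := by
  funext i
  have h : odoStep (!b) (odoStep b η) i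
      = xor (odoStep b η i) (decide (∀ j < i, odoStep b η j = !b)) := rfl
  have h2 : decide (∀ j < i, odoStep b η j = !b) = decide (∀ j < i, η j = b) :=
    decide_eq_decide.2 (odoStep_all b η i)
  rw [h, h2]
  simp [odoStep]

def odoVal (η : ℕ → Bool) : ℕ → ℕ
  | 0 => 0
  | n + 1 => odoVal η n + 2 ^ n * (η n).toNat

theorem odoVal_step (η : ℕ → Bool) (n : ℕ) :
    odoVal (odoStep true η) n + 2 ^ n * (decide (∀ j < n, η j = true)).toNat
      = odoVal η n + 1 := by
  induction n with
  | zero => simp [odoVal]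
  | succ n ih =>
    have h1 : odoStep true η n = xor (η n) (decide (∀ j < n, η j = true)) := rfl
    have h2 : decide (∀ j < n + 1, η j = true)
        = (decide (∀ j < n, η j = true) && η n) := by
      rw [Bool.eq_iff_iff]
      simp only [decide_eq_true_eq, Bool.and_eq_true, Nat.forall_lt_succ_right]
    simp only [odoVal]
    rw [h1, h2, pow_succ]
    generalize decide (∀ j < n, η j = true) = c at *
    cases c <;> cases η n <;> simp at * <;> omega

theorem odoVal_congr (η ν : ℕ → Bool) (n : ℕ) (h : ∀ i < n, η i = ν i) :
    odoVal η n = odoVal ν n := by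
  induction n with
  | zero => rfl
  | succ n ih =>
    simp only [odoVal]
    rw [ih fun i hi => h i (by omega), h n (by omega)]

theorem odoVal_iter (n m : ℕ) (η : ℕ → Bool) :
    odoVal ((odoStep true)^[m] η) n ≡ odoVal η n + m [MOD 2 ^ n] := by
  induction m with
  | zero => rfl
  | succ m ih =>
    rw [Function.iterate_succ_apply']
    have h := odoVal_step ((odoStep true)^[m] η) n
    have h3 : odoVal (odoStep true ((odoStep true)^[m] η)) n
        ≡ odoVal ((odoStep true)^[m] η) n + 1 [MOD 2 ^ n] := by
      rw [← h]
      simp [Nat.ModEq]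
    exact h3.trans (ih.add_right 1)

theorem exists_cantor_bijection :
    ∃ f : (ℕ → Bool) ≃ (ℕ → Bool),
      (∀ (η ν : ℕ → Bool) (n : ℕ), (∀ i < n, η i = ν i) → ∀ i < n, f η i = f ν i) ∧
      (∀ m : ℕ, 1 ≤ m → ∃ n : ℕ, ∀ η : ℕ → Bool, ¬ ∀ i < n, (⇑f)^[m] η i = η i) := by
  refine ⟨⟨odoStep true, odoStep false, odoStep_inv true, odoStep_inv false⟩, ?_, ?_⟩
  · intro η ν n h i hi
    change odoStep true η i = odoStep true ν i
    unfold odoStep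
    rw [h i hi]
    congr 1
    rw [decide_eq_decide]
    exact forall₂_congr fun j hj => by rw [h j (by omega)]
  · intro m hm
    refine ⟨m, fun η h => ?_⟩
    have h1 := odoVal_congr _ _ _ h
    have h2 := odoVal_iter m m η
    change odoVal ((odoStep true)^[m] η) m = _ at h1
    rw [h1] at h2
    have h3 : 0 ≡ m [MOD 2 ^ m] := Nat.ModEq.add_left_cancel' (odoVal η m) h2
    have h4 := Nat.le_of_dvd hm ((Nat.modEq_zero_iff_dvd).1 h3.symm)
    have h5 : m < 2 ^ m := Nat.lt_two_pow_self
    omega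
end

section
/- Let M′ be the L₁-structure described in the context and T′ = Th(M′). Then T′ is stable, and moreover T′ is small: for each n ∈ ℕ there are only countably many complete n-types over the empty set consistent with T′, i.e., countably many maximal consistent sets of L₁-formulas in n fixed free variables. -/
namespace FirstOrder

open Language Structure

namespace ShelahE34

/-- The relation symbols of the language `L₁`: binary symbols `Eₙ` (`n ∈ ℕ`), `E` and `E⁎`,
and unary symbols `Pₘ` (`m ∈ ℕ`). -/
inductive L1Rel : ℕ → Type
  | En : ℕ → L1Rel 2
  | E : L1Rel 2
  | Estar : L1Rel 2
  | P : ℕ → L1Rel 1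

/-- The language `L₁` (a relational language). -/
def L1 : Language.{0, 0} :=
  ⟨fun _ => Empty, L1Rel⟩

/-- The universe of the structure `M′`: quadruples `(η, k, n, ℓ)` with `η ∈ 2^ℕ`,
`k, n ∈ ℕ`, `ℓ ∈ {0, 1}` (as a Boolean). -/
def M1Point : Type :=
  (ℕ → Bool) × ℕ × ℕ × Bool

instance : Nonempty M1Point :=
  ⟨⟨fun _ => false, 0, 0, false⟩⟩

/-- The `L₁`-structure `M′`. -/
instance L1StructureM1Point : L1.Structure M1Point where
  funMap f _ := f.elim
  RelMap {m} r x :=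
    match r, x with
    | .En n, x => ∀ i < n, (x 0).1 i = (x 1).1 i
    | .E, x => (x 0).1 = (x 1).1 ∧ (x 0).2.1 = (x 1).2.1
    | .Estar, x => (x 0).1 = (x 1).1 ∧ (x 0).2.1 = (x 1).2.1 ∧ (x 0).2.2.1 = (x 1).2.2.1
    | .P m, x => (x 0).2.2.1 = m

/-- Initial agreement of binary sequences. -/
def ag (n : ℕ) (η θ : ℕ → Bool) : Prop := ∀ i < n, η i = θ i

theorem ag_succ {n : ℕ} {η θ : ℕ → Bool} : ag (n + 1) η θ ↔ ag n η θ ∧ η n = θ n := by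
  constructor
  · intro h
    exact ⟨fun i hi => h i (by omega), h n (by omega)⟩
  · rintro ⟨h1, h2⟩ i hi
    rcases Nat.lt_succ_iff_lt_or_eq.1 hi with h | rfl
    · exact h1 i h
    · exact h2

theorem ag_mono {m n : ℕ} (h : m ≤ n) {η θ : ℕ → Bool} (H : ag n η θ) : ag m η θ :=
  fun i hi => H i (by omega)

theorem ag_symm {n : ℕ} {η θ : ℕ → Bool} (H : ag n η θ) : ag n θ η :=
  fun i hi => (H i hi).symm

theorem ag_trans {n : ℕ} {η θ ζ : ℕ → Bool} (H : ag n η θ) (H' : ag n θ ζ) : ag n η ζ :=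
  fun i hi => (H i hi).trans (H' i hi)

theorem ag_congr_right {n : ℕ} {η θ ζ : ℕ → Bool} (H : ag n θ ζ) : ag n η θ ↔ ag n η ζ :=
  ⟨fun h => ag_trans h H, fun h => ag_trans h (ag_symm H)⟩

theorem ext_eta_s10 {ι : Type*} (f g : ι → (ℕ → Bool)) (a : ℕ → Bool) (K : ℕ)
    (H : ∀ n ≤ K, ∀ i j, ag n (f i) (f j) ↔ ag n (g i) (g j)) :
    ∃ θ : ℕ → Bool, ∀ n ≤ K, ∀ i, ag n (f i) a ↔ ag n (g i) θ := by
  induction K with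
  | zero =>
    refine ⟨a, fun n hn i => ?_⟩
    obtain rfl : n = 0 := by omega
    simp [ag]
  | succ K ih =>
    obtain ⟨θ, hθ⟩ := ih (fun n hn => H n (by omega))
    by_cases h1 : ∃ i, ag (K + 1) (f i) a
    · obtain ⟨i, hi⟩ := h1
      refine ⟨g i, fun n hn j => ?_⟩
      rw [← H n hn, ag_congr_right (ag_mono hn hi)]
    push Not at h1
    by_cases h2 : ∃ i, ag K (f i) a
    · obtain ⟨i, hi⟩ := h2
      have hflip : ag K (g i) (Function.update (g i) K (!(g i K))) := by
        intro t ht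
        rw [Function.update_of_ne (by omega)]
      have key : ∀ n ≤ K, ∀ j, ag n (f j) a ↔ ag n (g j) (Function.update (g i) K (!(g i K))) := by
        intro n hn j
        rw [← ag_congr_right (ag_mono hn hflip), ← H n (by omega), ag_congr_right (ag_mono hn hi)]
      refine ⟨Function.update (g i) K (!(g i K)), fun n hn j => ?_⟩
      rcases Nat.le_succ_iff.1 hn with hn | rfl
      · exact key n hn j
      · refine iff_of_false (h1 j) fun hj => ?_
        have hj' := ag_succ.1 hj
        have e1 := (key K le_rfl j).2 hj'.1
        have e2 : ag K (f j) (f i) := ag_trans e1 (ag_symm hi)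
        have e3 : ¬ ag (K + 1) (f j) (f i) := by
          rw [H _ le_rfl, ag_succ]
          rintro ⟨-, h⟩
          have := hj'.2
          rw [Function.update_self] at this
          rw [h] at this
          simp at this
        have e4 := h1 i
        have e5 := h1 j
        rw [ag_succ] at e3 e4 e5
        have e3' : f j K ≠ f i K := fun h => e3 ⟨e2, h⟩
        have e4' : f i K ≠ a K := fun h => e4 ⟨hi, h⟩
        have e5' : f j K ≠ a K := fun h => e5 ⟨e1, h⟩
        revert e3' e4' e5'
        cases f j K <;> cases f i K <;> cases a K <;> simp
    · push Not at h2
      refine ⟨θ, fun n hn j => ?_⟩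
      rcases Nat.le_succ_iff.1 hn with hn | rfl
      · exact hθ n hn j
      · refine iff_of_false (h1 j) fun hj => h2 j ?_
        exact (hθ K le_rfl j).2 (ag_mono (by omega) hj)

/-- The binary basic relations, as a uniform sequence. -/
def br {N : Type*} [L1.Structure N] : ℕ → N → N → Prop
  | 0, x, y => x = y
  | 1, x, y => RelMap (L := L1) L1Rel.E ![x, y]
  | 2, x, y => RelMap (L := L1) L1Rel.Estar ![x, y]
  | n + 3, x, y => RelMap (L := L1) (L1Rel.En n) ![x, y]

/-- The unary basic relations. -/
def pr {N : Type*} [L1.Structure N] (m : ℕ) (x : N) : Prop :=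
  RelMap (L := L1) (L1Rel.P m) ![x]

/-- The formulas for `br`. -/
def bf {ι : Type*} : ℕ → ι → ι → L1.Formula ι
  | 0, i, j => Term.equal (Term.var i) (Term.var j)
  | 1, i, j => Relations.formula₂ (L := L1) L1Rel.E (Term.var i) (Term.var j)
  | 2, i, j => Relations.formula₂ (L := L1) L1Rel.Estar (Term.var i) (Term.var j)
  | n + 3, i, j => Relations.formula₂ (L := L1) (L1Rel.En n) (Term.var i) (Term.var j)

/-- The formulas for `pr`. -/
def pf {ι : Type*} (m : ℕ) (i : ι) : L1.Formula ι :=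
  Relations.formula₁ (L := L1) (L1Rel.P m) (Term.var i)

theorem realize_bf {ι N : Type*} [L1.Structure N] (c : ℕ) (i j : ι) (v : ι → N) :
    (bf c i j).Realize v ↔ br c (v i) (v j) := by
  match c with
  | 0 => simp [bf, br]
  | 1 => exact Formula.realize_rel₂
  | 2 => exact Formula.realize_rel₂
  | n + 3 => exact Formula.realize_rel₂

theorem realize_pf {ι N : Type*} [L1.Structure N] (m : ℕ) (i : ι) (v : ι → N) :
    (pf m i).Realize v ↔ pr m (v i) := by
  exact Formula.realize_rel₁

theorem br0 {N : Type*} [L1.Structure N] (x y : N) : br 0 x y ↔ x = y := Iff.rfl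
theorem br1 (x y : M1Point) : br 1 x y ↔ x.1 = y.1 ∧ x.2.1 = y.2.1 := Iff.rfl
theorem br2 (x y : M1Point) :
    br 2 x y ↔ x.1 = y.1 ∧ x.2.1 = y.2.1 ∧ x.2.2.1 = y.2.2.1 := Iff.rfl
theorem br3 (n : ℕ) (x y : M1Point) : br (n + 3) x y ↔ ag n x.1 y.1 := Iff.rfl
theorem prM (m : ℕ) (x : M1Point) : pr m x ↔ x.2.2.1 = m := Iff.rfl

theorem M_ext (x y : M1Point) : x = y ↔
    (x.1 = y.1 ∧ x.2.1 = y.2.1 ∧ x.2.2.1 = y.2.2.1) ∧ x.2.2.2 = y.2.2.2 := by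
  constructor
  · rintro rfl; simp
  · rintro ⟨⟨h1, h2, h3⟩, h4⟩
    exact Prod.ext h1 (Prod.ext h2 (Prod.ext h3 h4))

theorem brM_symm (c : ℕ) (x y : M1Point) (h : br c x y) : br c y x := by
  match c with
  | 0 => exact Eq.symm h
  | 1 => exact ⟨h.1.symm, h.2.symm⟩
  | 2 => exact ⟨h.1.symm, h.2.1.symm, h.2.2.symm⟩
  | n + 3 => exact ag_symm h

theorem brM_trans (c : ℕ) (x y z : M1Point) (h : br c x y) (h' : br c y z) : br c x z := by
  match c with
  | 0 => exact Eq.trans h h'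
  | 1 => exact ⟨h.1.trans h'.1, h.2.trans h'.2⟩
  | 2 => exact ⟨h.1.trans h'.1, h.2.1.trans h'.2.1, h.2.2.trans h'.2.2⟩
  | n + 3 => exact ag_trans h h'

/-- Agreement of two tuples on all basic relations of level at most `K`. -/
structure Agree {ι N N' : Type*} [L1.Structure N] [L1.Structure N'] (K : ℕ)
    (f : ι → N) (g : ι → N') : Prop where
  hb : ∀ c < K + 4, ∀ i j, br c (f i) (f j) ↔ br c (g i) (g j)
  hp : ∀ m ≤ K, ∀ i, pr m (f i) ↔ pr m (g i)

theorem Agree.symm {ι N N' : Type*} [L1.Structure N] [L1.Structure N'] {K : ℕ}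
    {f : ι → N} {g : ι → N'} (h : Agree K f g) : Agree K g f :=
  ⟨fun c hc i j => (h.hb c hc i j).symm, fun m hm i => (h.hp m hm i).symm⟩

theorem Agree.mono {ι N N' : Type*} [L1.Structure N] [L1.Structure N'] {K K' : ℕ} (hK : K' ≤ K)
    {f : ι → N} {g : ι → N'} (h : Agree K f g) : Agree K' f g :=
  ⟨fun c hc i j => h.hb c (by omega) i j, fun m hm i => h.hp m (by omega) i⟩

theorem exists_big {ι : Type*} [Finite ι] (u : ι → ℕ) (K : ℕ) : ∃ k, K < k ∧ ∀ i, u i < k := by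
  obtain ⟨B, hB⟩ := (Set.finite_range u).bddAbove
  refine ⟨max B K + 1, by omega, fun i => ?_⟩
  have := hB ⟨i, rfl⟩
  omega

theorem ext_point {ι : Type*} [Finite ι] (K : ℕ) (f g : ι → M1Point) (h : Agree K f g)
    (a : M1Point) : ∃ b : M1Point, (∀ c < K + 4, ∀ i, br c (f i) a ↔ br c (g i) b) ∧
      ∀ m ≤ K, pr m a ↔ pr m b := by
  have H1 := h.hb 1 (by omega)
  have H2 := h.hb 2 (by omega)
  have H0 := h.hb 0 (by omega)
  have H3 : ∀ n ≤ K, ∀ i j, ag n (f i).1 (f j).1 ↔ ag n (g i).1 (g j).1 :=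
    fun n hn => h.hb (n + 3) (by omega)
  have HP := h.hp
  simp only [br0, br1, br2, prM] at H0 H1 H2 HP
  -- step 1
  obtain ⟨θ, k, hθ, hk⟩ : ∃ (θ : ℕ → Bool) (k : ℕ),
      (∀ n ≤ K, ∀ i, ag n (f i).1 a.1 ↔ ag n (g i).1 θ) ∧
      (∀ i, ((f i).1 = a.1 ∧ (f i).2.1 = a.2.1) ↔ ((g i).1 = θ ∧ (g i).2.1 = k)) := by
    by_cases hE : ∃ i, (f i).1 = a.1 ∧ (f i).2.1 = a.2.1
    · obtain ⟨i, hi1, hi2⟩ := hE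
      refine ⟨(g i).1, (g i).2.1, fun n hn j => ?_, fun j => ?_⟩
      · rw [← H3 n hn, hi1]
      · rw [← H1, hi1, hi2]
    · push Not at hE
      obtain ⟨θ, hθ⟩ := ext_eta_s10 (fun i => (f i).1) (fun i => (g i).1) a.1 K H3
      obtain ⟨k, -, hk⟩ := exists_big (fun i => (g i).2.1) 0
      refine ⟨θ, k, hθ, fun i => iff_of_false (fun h => hE i h.1 h.2) fun h => ?_⟩
      exact (hk i).ne h.2
  -- step 2
  obtain ⟨n, hn, hnP⟩ : ∃ n : ℕ,
      (∀ i, ((f i).1 = a.1 ∧ (f i).2.1 = a.2.1 ∧ (f i).2.2.1 = a.2.2.1) ↔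
        ((g i).1 = θ ∧ (g i).2.1 = k ∧ (g i).2.2.1 = n)) ∧
      (∀ m ≤ K, a.2.2.1 = m ↔ n = m) := by
    by_cases hE : ∃ i, (f i).1 = a.1 ∧ (f i).2.1 = a.2.1 ∧ (f i).2.2.1 = a.2.2.1
    · obtain ⟨i, hi1, hi2, hi3⟩ := hE
      have := (hk i).1 ⟨hi1, hi2⟩
      refine ⟨(g i).2.2.1, fun j => ?_, fun m hm => ?_⟩
      · rw [← this.1, ← this.2, ← H2, hi1, hi2, hi3]
      · rw [← HP m hm, hi3]
    · by_cases ha : a.2.2.1 ≤ K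
      · refine ⟨a.2.2.1, fun j => iff_of_false (fun h => hE ⟨j, h⟩) fun hj => ?_, fun m hm => Iff.rfl⟩
        have e := (hk j).2 ⟨hj.1, hj.2.1⟩
        exact hE ⟨j, e.1, e.2, (HP _ ha j).2 hj.2.2⟩
      · obtain ⟨n, hn1, hn⟩ := exists_big (fun i => (g i).2.2.1) K
        refine ⟨n, fun j => iff_of_false (fun h => hE ⟨j, h⟩) fun hj => (hn j).ne hj.2.2, ?_⟩
        intro m hm
        exact iff_of_false (by omega) (by omega)
  -- step 3
  obtain ⟨l, hl⟩ : ∃ l : Bool, ∀ i, f i = a ↔ g i = ((θ, k, n, l) : M1Point) := by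
    by_cases hE : ∃ i, f i = a
    · obtain ⟨i, rfl⟩ := hE
      refine ⟨(g i).2.2.2, fun j => ?_⟩
      rw [H0]
      have := (hn i).1 ⟨rfl, rfl, rfl⟩
      rw [← this.1, ← this.2.1, ← this.2.2]
      exact Iff.rfl
    · push Not at hE
      by_cases hS : ∃ i, (f i).1 = a.1 ∧ (f i).2.1 = a.2.1 ∧ (f i).2.2.1 = a.2.2.1
      · obtain ⟨i, hi⟩ := hS
        refine ⟨!(g i).2.2.2, fun j => iff_of_false (hE j) fun hj => ?_⟩
        have hj2 := (hn j).2 (by rw [hj]; exact ⟨rfl, rfl, rfl⟩)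
        have hne : f j ≠ f i := by
          rw [Ne, H0]
          intro h
          rw [h] at hj
          have : (g i).2.2.2 = !(g i).2.2.2 := congrArg (fun z : M1Point => z.2.2.2) hj
          simp at this
        have n1 := hE i
        have n2 := hE j
        rw [Ne, M_ext] at n1 n2 hne
        have n1' : (f i).2.2.2 ≠ a.2.2.2 := fun h => n1 ⟨hi, h⟩
        have n2' : (f j).2.2.2 ≠ a.2.2.2 := fun h => n2 ⟨hj2, h⟩
        have n3' : (f j).2.2.2 ≠ (f i).2.2.2 := fun h =>
          hne ⟨⟨hj2.1.trans hi.1.symm, hj2.2.1.trans hi.2.1.symm, hj2.2.2.trans hi.2.2.symm⟩, h⟩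
        revert n1' n2' n3'
        cases (f j).2.2.2 <;> cases (f i).2.2.2 <;> cases a.2.2.2 <;> simp
      · refine ⟨true, fun j => iff_of_false (hE j) fun hj => hS ⟨j, ?_⟩⟩
        exact (hn j).2 (by rw [hj]; exact ⟨rfl, rfl, rfl⟩)
  refine ⟨(θ, k, n, l), fun c hc i => ?_, hnP⟩
  match c with
  | 0 => exact hl i
  | 1 => exact hk i
  | 2 => exact hn i
  | c + 3 => exact hθ c (by omega) i

theorem term_var {ι : Type*} (t : L1.Term ι) : ∃ i, t = Term.var i := by
  cases t with
  | var i => exact ⟨i, rfl⟩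
  | func f _ => exact Empty.elim f

theorem qe {α : Type} [Finite α] {n : ℕ} (φ : L1.BoundedFormula α n) :
    ∃ K, ∀ (v w : α → M1Point) (xs ys : Fin n → M1Point),
      Agree K (Sum.elim v xs) (Sum.elim w ys) → (φ.Realize v xs ↔ φ.Realize w ys) := by
  induction φ with
  | falsum => exact ⟨0, fun _ _ _ _ _ => Iff.rfl⟩
  | equal t₁ t₂ =>
    obtain ⟨i, rfl⟩ := term_var t₁
    obtain ⟨j, rfl⟩ := term_var t₂
    exact ⟨0, fun v w xs ys h => h.hb 0 (by omega) i j⟩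
  | @rel n l R ts =>
    choose i hi using fun k => term_var (ts k)
    obtain rfl : ts = fun k => Term.var (i k) := funext hi
    cases R with
    | En m => exact ⟨m, fun v w xs ys h => h.hb (m + 3) (by omega) (i 0) (i 1)⟩
    | E => exact ⟨0, fun v w xs ys h => h.hb 1 (by omega) (i 0) (i 1)⟩
    | Estar => exact ⟨0, fun v w xs ys h => h.hb 2 (by omega) (i 0) (i 1)⟩
    | P m => exact ⟨m, fun v w xs ys h => h.hp m (by omega) (i 0)⟩
  | imp f₁ f₂ ih₁ ih₂ =>
    obtain ⟨K₁, h₁⟩ := ih₁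
    obtain ⟨K₂, h₂⟩ := ih₂
    refine ⟨max K₁ K₂, fun v w xs ys h => ?_⟩
    have e₁ := h₁ v w xs ys (h.mono (le_max_left _ _))
    have e₂ := h₂ v w xs ys (h.mono (le_max_right _ _))
    simp only [BoundedFormula.realize_imp, e₁, e₂]
  | @all n f ih =>
    obtain ⟨K, hK⟩ := ih
    have key : ∀ (v w : α → M1Point) (xs ys : Fin n → M1Point),
        Agree K (Sum.elim v xs) (Sum.elim w ys) → f.all.Realize w ys → f.all.Realize v xs := by
      intro v w xs ys h hw a
      obtain ⟨b, hb, hbp⟩ := ext_point K _ _ h a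
      refine (hK v w (Fin.snoc xs a) (Fin.snoc ys b) ?_).2 (hw b)
      have hrep : ∀ (i : α ⊕ Fin (n + 1)),
          (∃ j : α ⊕ Fin n, (Sum.elim v (Fin.snoc xs a : Fin (n+1) → M1Point) i = Sum.elim v xs j) ∧
            (Sum.elim w (Fin.snoc ys b : Fin (n+1) → M1Point) i = Sum.elim w ys j)) ∨
          (Sum.elim v (Fin.snoc xs a : Fin (n+1) → M1Point) i = a ∧
            Sum.elim w (Fin.snoc ys b : Fin (n+1) → M1Point) i = b) := by
        rintro (i | i)
        · exact Or.inl ⟨Sum.inl i, rfl, rfl⟩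
        · refine Fin.lastCases ?_ (fun i => ?_) i
          · right; simp
          · left; exact ⟨Sum.inr i, by simp, by simp⟩
      constructor
      · intro c hc i j
        rcases hrep i with ⟨i', h1, h2⟩ | ⟨h1, h2⟩ <;> rcases hrep j with ⟨j', h3, h4⟩ | ⟨h3, h4⟩ <;>
          rw [h1, h2, h3, h4]
        · exact h.hb c hc i' j'
        · exact hb c hc i'
        · have := hb c hc j'
          exact ⟨fun h => brM_symm _ _ _ (this.1 (brM_symm _ _ _ h)),
            fun h => brM_symm _ _ _ (this.2 (brM_symm _ _ _ h))⟩
        · have hr : ∀ z : M1Point, br c z z := by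
            intro z
            match c with
            | 0 => exact rfl
            | 1 => exact ⟨rfl, rfl⟩
            | 2 => exact ⟨rfl, rfl, rfl⟩
            | c + 3 => exact fun _ _ => rfl
          exact iff_of_true (hr _) (hr _)
      · intro m hm i
        rcases hrep i with ⟨i', h1, h2⟩ | ⟨h1, h2⟩ <;> rw [h1, h2]
        · exact h.hp m hm i'
        · exact hbp m hm
    exact ⟨K, fun v w xs ys h => ⟨key w v ys xs h.symm, key v w xs ys h⟩⟩

theorem transfer_s10 {L : Language.{0, 0}} {M : Type} [L.Structure M] {N : Type*} [L.Structure N]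
    [N ⊨ L.completeTheory M] {α β : Type} [Finite α] [Finite β] (F : β → L.Formula α)
    (v : α → N) : ∃ v' : α → M, ∀ b, (F b).Realize v ↔ (F b).Realize v' := by
  classical
  let G : β → L.Formula α := fun b => if (F b).Realize v then F b else (F b).not
  let χ : L.Formula (Empty ⊕ α) := (Formula.iInf G).relabel Sum.inr
  let σ : L.Sentence := χ.iExs α
  have hN : N ⊨ σ := by
    refine Formula.realize_iExs.2 ⟨v, ?_⟩
    rw [Formula.realize_relabel, Formula.realize_iInf]
    intro b
    simp only [G, Sum.elim_comp_inr]
    split_ifs with h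
    · exact h
    · exact h
  have hM : M ⊨ σ := (realize_iff_of_model_completeTheory M N σ).1 hN
  obtain ⟨v', hv'⟩ := Formula.realize_iExs.1 hM
  rw [Formula.realize_relabel, Formula.realize_iInf] at hv'
  refine ⟨v', fun b => ?_⟩
  have := hv' b
  simp only [G, Sum.elim_comp_inr] at this
  split_ifs at this with h
  · exact iff_of_true h this
  · exact iff_of_false h this

/-- Atomic formulas of level at most `K`. -/
def af {α : Type} (K : ℕ) : (Fin (K + 4) × α × α) ⊕ (Fin (K + 1) × α) → L1.Formula α
  | Sum.inl x => bf x.1 x.2.1 x.2.2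
  | Sum.inr x => pf x.1 x.2

theorem down {α : Type} [Finite α] {N : Type*} [L1.Structure N]
    [N ⊨ L1.completeTheory M1Point] (K : ℕ) (φ : L1.Formula α) (v : α → N) :
    ∃ v' : α → M1Point, Agree K v v' ∧ (φ.Realize v ↔ φ.Realize v') := by
  obtain ⟨v', h⟩ := transfer_s10 (M := M1Point) (fun o : Option _ => o.elim φ (af K)) v
  refine ⟨v', ⟨fun c hc i j => ?_, fun m hm i => ?_⟩, h none⟩
  · have := h (some (Sum.inl (⟨c, hc⟩, i, j)))
    simpa only [Option.elim, af, realize_bf] using this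
  · have := h (some (Sum.inr (⟨m, by omega⟩, i)))
    simpa only [Option.elim, af, realize_pf] using this

theorem Agree.trans {ι N N' N'' : Type*} [L1.Structure N] [L1.Structure N'] [L1.Structure N'']
    {K : ℕ} {f : ι → N} {g : ι → N'} {e : ι → N''} (h : Agree K f g) (h' : Agree K g e) :
    Agree K f e :=
  ⟨fun c hc i j => (h.hb c hc i j).trans (h'.hb c hc i j),
    fun m hm i => (h.hp m hm i).trans (h'.hp m hm i)⟩

theorem qeN {α : Type} [Finite α] (φ : L1.Formula α) :
    ∃ K, ∀ (N : Type u) (N' : Type w) [L1.Structure N] [L1.Structure N']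
      [N ⊨ L1.completeTheory M1Point] [N' ⊨ L1.completeTheory M1Point]
      (v : α → N) (w : α → N'), Agree K v w → (φ.Realize v ↔ φ.Realize w) := by
  obtain ⟨K, hK⟩ := qe φ
  refine ⟨K, fun N N' _ _ _ _ v w h => ?_⟩
  obtain ⟨v', hv, hv'⟩ := down K φ v
  obtain ⟨w', hw, hw'⟩ := down K φ w
  rw [hv', hw']
  refine hK v' w' default default ?_
  have := (hv.symm.trans h).trans hw
  constructor
  · rintro c hc (i | i) (j | j)
    · exact this.hb c hc i j
    · exact j.elim0
    · exact i.elim0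
    · exact i.elim0
  · rintro m hm (i | i)
    · exact this.hp m hm i
    · exact i.elim0

theorem br_rect {N : Type*} [L1.Structure N] [N ⊨ L1.completeTheory M1Point] (c : ℕ)
    (x x' y y' : N) (h1 : br c x y) (h2 : br c x' y) (h3 : br c x' y') : br c x y' := by
  obtain ⟨v', h, -⟩ := down c ⊥ ![x, x', y, y']
  have h := h.hb c (by omega)
  refine (h 0 3).2 ?_
  have e1 := (h 0 2).1 h1
  have e2 := (h 1 2).1 h2
  have e3 := (h 1 3).1 h3
  exact brM_trans _ _ _ _ e1 (brM_trans _ _ _ _ (brM_symm _ _ _ e2) e3)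

theorem br_anti {N : Type*} [L1.Structure N] [N ⊨ L1.completeTheory M1Point] {m n : ℕ}
    (hmn : m ≤ n) (x y : N) (h1 : br (n + 3) x y) : br (m + 3) x y := by
  obtain ⟨v', h, -⟩ := down n ⊥ ![x, y]
  exact (h.hb (m + 3) (by omega) 0 1).2
    (ag_mono hmn ((h.hb (n + 3) (by omega) 0 1).1 h1))

theorem pr_unique {N : Type*} [L1.Structure N] [N ⊨ L1.completeTheory M1Point] {m n : ℕ}
    (x : N) (h1 : pr m x) (h2 : pr n x) : m = n := by
  obtain ⟨v', h, -⟩ := down (max m n) ⊥ ![x]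
  have e1 : pr m (v' 0) := (h.hp m (le_max_left _ _) 0).1 h1
  have e2 : pr n (v' 0) := (h.hp n (le_max_right _ _) 0).1 h2
  exact (e1 : _ = m).symm.trans e2

open Filter in
theorem rect_comm (U : Ultrafilter ℕ) (R : ℕ → ℕ → Prop)
    (hR : ∀ i i' j j', R i j → R i' j → R i' j' → R i j')
    (h : ∀ᶠ i in U, ∀ᶠ j in U, R i j) : ∀ᶠ j in U, ∀ᶠ i in U, R i j := by
  obtain ⟨i0, h0⟩ := h.exists
  filter_upwards [h0] with j hj
  filter_upwards [h] with i hi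
  obtain ⟨j', h1, h2⟩ := (hi.and h0).exists
  exact hR i i0 j' j h1 h2 hj

open Filter in
theorem rect_limit (U : Ultrafilter ℕ) (R : ℕ → ℕ → Prop)
    (hR : ∀ i i' j j', R i j → R i' j → R i' j' → R i j') :
    ∃ t : Prop, (∀ᶠ i in U, ∀ᶠ j in U, (R i j ↔ t)) ∧ ∀ᶠ j in U, ∀ᶠ i in U, (R i j ↔ t) := by
  by_cases h : ∀ᶠ i in U, ∀ᶠ j in U, R i j
  · exact ⟨True, by simpa using h, by simpa using rect_comm U R hR h⟩
  · refine ⟨False, ?_, ?_⟩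
    · simp only [iff_false]
      simpa only [← Ultrafilter.eventually_not] using h
    · simp only [iff_false, Ultrafilter.eventually_not]
      intro h'
      exact h (rect_comm U (fun j i => R i j) (fun i i' j j' a b c => hR j' j i' i c b a) h')

theorem stable_part : IsStableTheory.{0, 0, u} (L1.completeTheory M1Point) := by
  rintro ⟨nx, ny, φ, N, a, b, H⟩
  obtain ⟨K, hK⟩ := qeN.{u, u} φ
  let U : Ultrafilter ℕ := Filter.hyperfilter ℕ
  let A := (Fin (K + 4) × (Fin nx ⊕ Fin ny) × (Fin nx ⊕ Fin ny)) ⊕ (Fin (K + 1) × (Fin nx ⊕ Fin ny))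
  let R : A → ℕ → ℕ → Prop := fun x i j => (af K x).Realize (Sum.elim (a i) (b j))
  have hR : ∀ x i i' j j', R x i j → R x i' j → R x i' j' → R x i j' := by
    rintro (⟨c, p | p, q | q⟩ | ⟨m, p | p⟩) i i' j j' <;>
      simp only [R, af, realize_bf, realize_pf, Sum.elim_inl, Sum.elim_inr] <;> intro h1 h2 h3
    · exact h1
    · exact br_rect _ _ _ _ _ h1 h2 h3
    · have sym : ∀ x y : N, br (c : ℕ) x y → br (c : ℕ) y x := by
        intro x y h
        obtain ⟨v', h', -⟩ := down c ⊥ ![x, y]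
        exact (h'.hb c (by omega) 1 0).2 (brM_symm _ _ _ ((h'.hb c (by omega) 0 1).1 h))
      exact sym _ _ (br_rect _ _ _ _ _ (sym _ _ h1) (sym _ _ h2) (sym _ _ h3))
    · exact h3
    · exact h1
    · exact h3
  choose t ht1 ht2 using fun x => rect_limit U (R x) (hR x)
  have F1 : ∀ᶠ i in (U : Filter ℕ), ∀ᶠ j in (U : Filter ℕ), ∀ x, (R x i j ↔ t x) := by
    simp only [Filter.eventually_all]
    exact ht1
  have F2 : ∀ᶠ j in (U : Filter ℕ), ∀ᶠ i in (U : Filter ℕ), ∀ x, (R x i j ↔ t x) := by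
    simp only [Filter.eventually_all]
    exact ht2
  have big : ∀ n : ℕ, ∀ᶠ i in (U : Filter ℕ), n < i := fun n => by
    have : (U : Filter ℕ) ≤ Filter.atTop := Nat.hyperfilter_le_atTop
    exact this (Filter.eventually_gt_atTop n)
  obtain ⟨i, hi⟩ := F1.exists
  obtain ⟨j, hj, hij⟩ := (hi.and (big i)).exists
  obtain ⟨j', hj'⟩ := F2.exists
  obtain ⟨i', hi', hij'⟩ := (hj'.and (big j')).exists
  have hA : Agree K (Sum.elim (a i) (b j)) (Sum.elim (a i') (b j')) := by
    constructor
    · intro c hc p q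
      have := (hj (Sum.inl (⟨c, hc⟩, p, q))).trans (hi' (Sum.inl (⟨c, hc⟩, p, q))).symm
      simpa only [R, af, realize_bf] using this
    · intro m hm p
      have := (hj (Sum.inr (⟨m, by omega⟩, p))).trans (hi' (Sum.inr (⟨m, by omega⟩, p))).symm
      simpa only [R, af, realize_pf] using this
  have e := hK N N _ _ hA
  rw [H, H] at e
  omega

theorem lower_mem (s : Set ℕ) (h : ∀ m n, m ≤ n → n ∈ s → m ∈ s) :
    s ∈ Set.range (fun o : Option ℕ => o.elim Set.univ Set.Iio) := by
  classical
  by_cases hs : ∃ n, n ∉ s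
  · refine ⟨some (Nat.find hs), ?_⟩
    ext m
    simp only [Option.elim, Set.mem_Iio, Nat.lt_find_iff, not_not]
    exact ⟨fun H => H m le_rfl, fun H k hk => h k m hk H⟩
  · push Not at hs
    exact ⟨none, by ext m; simp [hs m]⟩

theorem sub_mem (s : Set ℕ) (h : ∀ m n, m ∈ s → n ∈ s → m = n) :
    s ∈ Set.range (fun o : Option ℕ => o.elim ∅ (fun n => ({n} : Set ℕ))) := by
  rcases Set.eq_empty_or_nonempty s with rfl | ⟨n, hn⟩
  · exact ⟨none, rfl⟩
  · refine ⟨some n, ?_⟩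
    ext m
    simp only [Option.elim, Set.mem_singleton_iff]
    exact ⟨fun e => e ▸ hn, fun e => h _ _ e hn⟩

theorem small_part (n : ℕ) :
    Countable (Theory.CompleteType (L1.completeTheory M1Point) (Fin n)) := by
  choose N hN using fun p : Theory.CompleteType (L1.completeTheory M1Point) (Fin n) =>
    Theory.exists_modelType_is_realized_in _ p
  choose v hv using hN
  let code : Theory.CompleteType (L1.completeTheory M1Point) (Fin n) →
      (Fin 3 → Fin n → Fin n → Prop) ×
      (Fin n → Fin n → Set.range (fun o : Option ℕ => o.elim Set.univ Set.Iio)) ×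
      (Fin n → Set.range (fun o : Option ℕ => o.elim ∅ (fun n => ({n} : Set ℕ)))) := fun p =>
    (fun c i j => br (c : ℕ) (v p i) (v p j),
      fun i j => ⟨{m | br (m + 3) (v p i) (v p j)},
        lower_mem _ fun m k h => br_anti h _ _⟩,
      fun i => ⟨{m | pr m (v p i)}, sub_mem _ fun m k h h' => pr_unique _ h h'⟩)
  have c1 : Countable (Set.range (fun o : Option ℕ => o.elim Set.univ Set.Iio)) :=
    (Set.countable_range _).to_subtype
  have c2 : Countable (Set.range (fun o : Option ℕ => o.elim ∅ (fun n => ({n} : Set ℕ)))) :=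
    (Set.countable_range _).to_subtype
  have c3 : Countable Prop := Finite.to_countable
  refine Function.Injective.countable (f := code) fun p q hpq => ?_
  have h1 : ∀ c < 3, ∀ i j, br c (v p i) (v p j) ↔ br c (v q i) (v q j) := by
    intro c hc i j
    exact iff_of_eq (congrFun (congrFun (congrFun (congrArg Prod.fst hpq) ⟨c, hc⟩) i) j)
  have h2 : ∀ m i j, br (m + 3) (v p i) (v p j) ↔ br (m + 3) (v q i) (v q j) := by
    intro m i j
    have := congrArg Subtype.val (congrFun (congrFun (congrArg (fun z => z.2.1) hpq) i) j)
    exact Set.ext_iff.1 this m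
  have h3 : ∀ m i, pr m (v p i) ↔ pr m (v q i) := by
    intro m i
    have := congrArg Subtype.val (congrFun (congrArg (fun z => z.2.2) hpq) i)
    exact Set.ext_iff.1 this m
  refine SetLike.ext fun φ => ?_
  have e : ∀ p, φ ∈ p ↔ (Formula.equivSentence.symm φ).Realize (v p) := by
    intro p
    conv_lhs => rw [← hv p]
    exact Theory.CompleteType.mem_typeOf
  rw [e, e]
  obtain ⟨K, hK⟩ := qeN.{0, 0} (Formula.equivSentence.symm φ)
  refine hK (N p) (N q) _ _ ⟨fun c hc i j => ?_, fun m _ i => h3 m i⟩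
  match c with
  | 0 => exact h1 0 (by omega) i j
  | 1 => exact h1 1 (by omega) i j
  | 2 => exact h1 2 (by omega) i j
  | c + 3 => exact h2 c i j

theorem ThM1_stable_and_small :
    IsStableTheory.{0, 0, u} (L1.completeTheory M1Point) ∧
    ∀ n : ℕ, Countable (Theory.CompleteType (L1.completeTheory M1Point) (Fin n)) := by
  exact ⟨stable_part, small_part⟩

end ShelahE34

end FirstOrder
end
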